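/- Fix x ∈ Ω and assume that for Lebesgue-almost every s ∈ [0,1] the function y ↦ c(x,y) − ψ_s(y) has a unique minimizer over Ω. Then for any selection s ↦ T_s of minimizers (the value v(T_s) is independent of the selection for a.e. s), the function s ↦ v(T_s) agrees almost everywhere with a Lebesgue-integrable function on [0,1] and φ_1(x) − φ_0(x) = −∫_0^1 v(T_s) ds. -/

import Mathlib

open MeasureTheory

/-- `phiPot c ψ0 v s x = min_{y} (c x y - (ψ0 y + s v y))`, i.e. the `c`-transform of
`ψ_s = ψ0 + s v` evaluated at `x` (the minimum equals the infimum by compactness). -/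
noncomputable def phiPot {Ω : Type*} (c : Ω → Ω → ℝ) (ψ0 v : Ω → ℝ) (s : ℝ) (x : Ω) : ℝ :=
  ⨅ y : Ω, (c x y - (ψ0 y + s * v y))

section Subgradient

variable {F w : ℝ → ℝ} {a b : ℝ}

/-- A selection of subgradients is monotone. -/
theorem monotoneOn_of_subgradient
    (h : ∀ s ∈ Set.Icc a b, ∀ t ∈ Set.Icc a b, F s + w s * (t - s) ≤ F t) :
    MonotoneOn w (Set.Icc a b) := by
  intro s hs t ht hst
  rcases hst.eq_or_lt with rfl | hlt
  · exact le_rfl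
  · have h₁ := h s hs t ht
    have h₂ := h t ht s hs
    nlinarith

theorem abs_sub_sub_mul_le_of_subgradient
    (h : ∀ s ∈ Set.Icc a b, ∀ t ∈ Set.Icc a b, F s + w s * (t - s) ≤ F t)
    {s t : ℝ} (hs : s ∈ Set.Icc a b) (ht : t ∈ Set.Icc a b) :
    |F t - F s - (t - s) * w s| ≤ |w t - w s| * |t - s| := by
  have h₁ := h s hs t ht
  have h₂ := h t ht s hs
  rw [← abs_mul, abs_of_nonneg (by linarith)]
  refine le_trans ?_ (le_abs_self _)
  linarith

theorem continuousOn_of_subgradient (hab : a ≤ b)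
    (h : ∀ s ∈ Set.Icc a b, ∀ t ∈ Set.Icc a b, F s + w s * (t - s) ≤ F t) :
    ContinuousOn F (Set.Icc a b) := by
  have hmono := monotoneOn_of_subgradient h
  intro s hs
  have hlim : Filter.Tendsto (fun t => |w s| * |t - s| + (w b - w a) * |t - s|)
      (nhdsWithin s (Set.Icc a b)) (nhds 0) := by
    have : ContinuousWithinAt (fun t => |w s| * |t - s| + (w b - w a) * |t - s|)
        (Set.Icc a b) s := by fun_prop
    simpa [ContinuousWithinAt] using this
  refine tendsto_iff_dist_tendsto_zero.2 (squeeze_zero' (.of_forall fun _ => dist_nonneg) ?_ hlim)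
  filter_upwards [self_mem_nhdsWithin] with t ht
  have h₁ := abs_sub_sub_mul_le_of_subgradient h hs ht
  have h₂ : |w t - w s| ≤ w b - w a := by
    have hta := hmono (Set.left_mem_Icc.2 hab) ht ht.1
    have htb := hmono ht (Set.right_mem_Icc.2 hab) ht.2
    have hsa := hmono (Set.left_mem_Icc.2 hab) hs hs.1
    have hsb := hmono hs (Set.right_mem_Icc.2 hab) hs.2
    exact abs_le.2 ⟨by linarith, by linarith⟩
  have h₃ := mul_le_mul_of_nonneg_right h₂ (abs_nonneg (t - s))
  have h₄ : |F t - F s| ≤ |F t - F s - (t - s) * w s| + |(t - s) * w s| := by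
    simpa using abs_add_le (F t - F s - (t - s) * w s) ((t - s) * w s)
  rw [abs_mul] at h₄
  rw [Real.dist_eq]
  linarith

theorem hasDerivAt_of_subgradient
    (h : ∀ s ∈ Set.Icc a b, ∀ t ∈ Set.Icc a b, F s + w s * (t - s) ≤ F t)
    {s : ℝ} (hs : s ∈ Set.Ioo a b) (hw : ContinuousWithinAt w (Set.Icc a b) s) :
    HasDerivAt F (w s) s := by
  have hmem : Set.Icc a b ∈ nhds s := Icc_mem_nhds hs.1 hs.2
  have hw' := Metric.continuousAt_iff'.1 (hw.continuousAt hmem)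
  rw [hasDerivAt_iff_isLittleO, Asymptotics.isLittleO_iff]
  intro ε hε
  filter_upwards [hmem, hw' ε hε] with t ht hwt
  refine (abs_sub_sub_mul_le_of_subgradient h (Set.Ioo_subset_Icc_self hs) ht).trans ?_
  exact mul_le_mul_of_nonneg_right hwt.le (abs_nonneg _)

/-- A function on a compact interval is recovered by integrating any selection of its
subgradients. -/
theorem integral_subgradient_eq_sub (hab : a ≤ b)
    (h : ∀ s ∈ Set.Icc a b, ∀ t ∈ Set.Icc a b, F s + w s * (t - s) ≤ F t) :
    ∫ s in a..b, w s = F b - F a := by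
  have hmono := monotoneOn_of_subgradient h
  refine integral_eq_of_hasDerivAt_off_countable_of_le F w hab
    hmono.countable_not_continuousWithinAt (continuousOn_of_subgradient hab h) ?_
    (MonotoneOn.intervalIntegrable (by rwa [Set.uIcc_of_le hab]))
  intro s hs
  have hs' := Set.Ioo_subset_Icc_self hs.1
  exact hasDerivAt_of_subgradient h hs.1 (by_contra fun hn => hs.2 ⟨hs', hn⟩)

end Subgradient

theorem phiPot_eq_of_forall_le {Ω : Type*} {c : Ω → Ω → ℝ} {ψ0 v : Ω → ℝ} {s : ℝ} {x y : Ω}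
    (hy : ∀ z, c x y - (ψ0 y + s * v y) ≤ c x z - (ψ0 z + s * v z)) :
    phiPot c ψ0 v s x = c x y - (ψ0 y + s * v y) :=
  IsLeast.csInf_eq ⟨⟨y, rfl⟩, Set.forall_mem_range.2 hy⟩

/-- if for a.e. `s ∈ [0,1]` the map `y ↦ c(x,y) - ψ_s(y)` has a unique minimizer,
then for any selection `T` of minimizers, `s ↦ v(T_s)` agrees a.e. on `[0,1]` with a Lebesgue
integrable function, and `φ_1(x) - φ_0(x) = -∫_0^1 v(T_s) ds`. -/
theorem stmt4 {Ω : Type*} [MetricSpace Ω] [CompactSpace Ω] [Nonempty Ω]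
    (c : Ω → Ω → ℝ) (hc : Continuous fun p : Ω × Ω => c p.1 p.2)
    (ψ0 ψ1 : Ω → ℝ) (hψ0 : Continuous ψ0) (hψ1 : Continuous ψ1)
    (v : Ω → ℝ) (hv : ∀ y, v y = ψ1 y - ψ0 y)
    (x : Ω)
    (huniq : ∀ᵐ s ∂(volume.restrict (Set.Icc (0 : ℝ) 1)),
      ∃! y : Ω, ∀ z : Ω, c x y - (ψ0 y + s * v y) ≤ c x z - (ψ0 z + s * v z))
    (T : ℝ → Ω)
    (hT : ∀ s ∈ Set.Icc (0 : ℝ) 1, ∀ z : Ω,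
      c x (T s) - (ψ0 (T s) + s * v (T s)) ≤ c x z - (ψ0 z + s * v z)) :
    (∃ h : ℝ → ℝ, IntegrableOn h (Set.Icc (0 : ℝ) 1) ∧
      ∀ᵐ s ∂(volume.restrict (Set.Icc (0 : ℝ) 1)), v (T s) = h s) ∧
    phiPot c ψ0 v 1 x - phiPot c ψ0 v 0 x = -∫ s in (0 : ℝ)..1, v (T s) := by
  have hsub : ∀ s ∈ Set.Icc (0 : ℝ) 1, ∀ t ∈ Set.Icc (0 : ℝ) 1,
      -phiPot c ψ0 v s x + v (T s) * (t - s) ≤ -phiPot c ψ0 v t x := by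
    intro s hs t ht
    rw [phiPot_eq_of_forall_le (hT s hs), phiPot_eq_of_forall_le (hT t ht)]
    linarith [hT t ht (T s)]
  refine ⟨⟨fun s => v (T s), (monotoneOn_of_subgradient hsub).integrableOn_isCompact isCompact_Icc,
    .of_forall fun _ => rfl⟩, ?_⟩
  rw [integral_subgradient_eq_sub (F := fun s => -phiPot c ψ0 v s x) zero_le_one hsub]
  ring
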